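/- arXiv:2208.07586 — 3 statements merged into one kernel-verified Lean document; each statement's English description precedes it below -/
import Mathlib

section
/- Let r₁, r₂, m be integers with 0 < r₁ < r₂ < r₁ + r₂ ≤ m and r₁ even. Let C and D be sets of nonnegative integers such that C ∪ D = [0, m], C ∩ D = {r₁, r₂}, and 0 ∈ C. If R_C(n) = R_D(n) for every integer n ∈ [0, m], then r₂ = 2^⌈log₂ r₂⌉ − 1, i.e., r₂ + 1 is a power of 2. -/
/-- `R S n` is the number of pairs `(s, s')` with `s, s' ∈ S`, `s < s'` and `s + s' = n`. -/
noncomputable def R (S : Set ℕ) (n : ℕ) : ℕ :=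
  Set.ncard {p : ℕ × ℕ | p.1 ∈ S ∧ p.2 ∈ S ∧ p.1 < p.2 ∧ p.1 + p.2 = n}

/-- `AP r m` is the arithmetic progression `r + mℕ = {r + m*k : k ∈ ℕ}`. -/
def AP (r m : ℕ) : Set ℕ := {n | ∃ k : ℕ, n = r + m * k}

/-- The Thue–Morse sequence with values `1` and `-1`. -/
def thueMorse (n : ℕ) : ℤ := (-1) ^ (Nat.digits 2 n).sum

theorem thueMorse_zero : thueMorse 0 = 1 := by simp [thueMorse]

theorem thueMorse_two_mul (n : ℕ) : thueMorse (2 * n) = thueMorse n := by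
  rcases Nat.eq_zero_or_pos n with rfl | hn
  · simp
  · unfold thueMorse
    rw [Nat.digits_def' (by norm_num) (by omega : 0 < 2 * n)]
    simp

theorem thueMorse_two_mul_add_one (n : ℕ) : thueMorse (2 * n + 1) = -thueMorse n := by
  unfold thueMorse
  rw [Nat.digits_def' (by norm_num) (by omega : 0 < 2 * n + 1)]
  have h₁ : (2 * n + 1) % 2 = 1 := by omega
  have h₂ : (2 * n + 1) / 2 = n := by omega
  rw [h₁, h₂, List.sum_cons, pow_add]
  ring

theorem thueMorse_eq_one_or (n : ℕ) : thueMorse n = 1 ∨ thueMorse n = -1 :=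
  neg_one_pow_eq_or ℤ _

theorem thueMorse_one : thueMorse 1 = -1 := by simp [thueMorse]

theorem thueMorse_two : thueMorse 2 = -1 := by simp [thueMorse]

theorem thueMorse_pow_mul_add (u a b : ℕ) (hb : b < 2 ^ u) :
    thueMorse (2 ^ u * a + b) = thueMorse a * thueMorse b := by
  induction u generalizing b with
  | zero =>
    obtain rfl : b = 0 := by simpa using hb
    simp [thueMorse_zero]
  | succ u ih =>
    rw [pow_succ] at hb
    obtain ⟨c, rfl | rfl⟩ := Nat.even_or_odd' b
    · rw [show 2 ^ (u + 1) * a + 2 * c = 2 * (2 ^ u * a + c) by ring, thueMorse_two_mul,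
        thueMorse_two_mul, ih c (by omega)]
    · rw [show 2 ^ (u + 1) * a + (2 * c + 1) = 2 * (2 ^ u * a + c) + 1 by ring,
        thueMorse_two_mul_add_one, thueMorse_two_mul_add_one, ih c (by omega)]
      ring

theorem thueMorse_pow_mul (u a : ℕ) : thueMorse (2 ^ u * a) = thueMorse a := by
  simpa [thueMorse_zero] using thueMorse_pow_mul_add u a 0 (by positivity)

theorem thueMorse_pow (u : ℕ) : thueMorse (2 ^ u) = -1 := by
  simpa [thueMorse_one] using thueMorse_pow_mul u 1

theorem thueMorse_pow_add (u b : ℕ) (hb : b < 2 ^ u) :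
    thueMorse (2 ^ u + b) = -thueMorse b := by
  simpa [thueMorse_one] using thueMorse_pow_mul_add u 1 b hb

theorem thueMorse_succ_of_even {n : ℕ} (hn : Even n) : thueMorse (n + 1) = -thueMorse n := by
  obtain ⟨k, rfl⟩ := hn.two_dvd
  rw [thueMorse_two_mul_add_one, thueMorse_two_mul]

/-- After a sign change at an odd `q`, the sequence changes sign again, and `q ≡ 3 (mod 4)`. -/
theorem thueMorse_add_two_of_odd {q : ℕ} (hq : Odd q) (h : thueMorse (q + 1) = -thueMorse q) :
    thueMorse (q + 2) = thueMorse q ∧ q % 4 = 3 := by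
  obtain ⟨p, rfl⟩ := hq
  have e₁ : thueMorse (2 * p + 1 + 1) = thueMorse (p + 1) := thueMorse_two_mul (p + 1)
  have e₂ : thueMorse (2 * p + 1 + 2) = -thueMorse (p + 1) := thueMorse_two_mul_add_one (p + 1)
  have e₃ := thueMorse_two_mul_add_one p
  refine ⟨by omega, ?_⟩
  by_contra hp
  have e₄ := thueMorse_succ_of_even (n := p) (by rw [Nat.even_iff]; omega)
  have e₅ := thueMorse_eq_one_or p
  omega

theorem exists_thueMorse_add_ne {p k : ℕ} (hp : 0 < p) (hk : p < 2 ^ k)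
    (h : ∀ u ≤ k, p + 2 ^ u ≠ 2 ^ k) :
    ∃ c, p + c + 1 < 2 ^ k ∧ thueMorse (p + c) ≠ thueMorse p * thueMorse c := by
  obtain ⟨u, q, hq, rfl⟩ := Nat.exists_eq_two_pow_mul_odd hp.ne'
  have huk : u < k := by
    by_contra hcon
    have : 2 ^ k ≤ 2 ^ u := Nat.pow_le_pow_right (by norm_num) (by omega)
    have : 1 ≤ q := hq.pos
    nlinarith
  obtain ⟨w, rfl⟩ := Nat.exists_eq_add_of_lt huk
  have hU : 0 < 2 ^ u := by positivity
  have hpow : 2 ^ (u + w + 1) = 2 ^ u * 2 ^ (w + 1) := by ring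
  rw [hpow] at hk h ⊢
  have hqw : q < 2 ^ (w + 1) := lt_of_mul_lt_mul_left hk (by positivity)
  have hq1 : q + 1 ≠ 2 ^ (w + 1) := fun e => h u (by omega) (by rw [← e]; ring)
  obtain ⟨e, rfl⟩ := hq
  have hw : 2 * e + 4 ≤ 2 ^ (w + 1) := by rw [pow_succ] at *; omega
  by_cases hs : thueMorse (2 * e + 1 + 1) = -thueMorse (2 * e + 1)
  · obtain ⟨h2, h3⟩ := thueMorse_add_two_of_odd ⟨e, rfl⟩ hs
    have hw5 : 2 * e + 1 + 5 ≤ 2 ^ (w + 1) := by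
      rcases w with - | w
      · omega
      · rw [pow_succ, pow_succ] at *; omega
    refine ⟨2 ^ (u + 1), ?_, ?_⟩
    · calc _ < 2 ^ u * (2 * e + 1 + 5) := by rw [pow_succ]; nlinarith
        _ ≤ _ := Nat.mul_le_mul_left _ hw5
    · rw [show 2 ^ u * (2 * e + 1) + 2 ^ (u + 1) = 2 ^ u * (2 * e + 1 + 2) by ring,
        thueMorse_pow_mul, thueMorse_pow_mul, thueMorse_pow, h2]
      have := thueMorse_eq_one_or (2 * e + 1)
      omega
  · refine ⟨2 ^ u, ?_, ?_⟩
    · calc _ < 2 ^ u * (2 * e + 4) := by nlinarith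
        _ ≤ _ := Nat.mul_le_mul_left _ hw
    · rw [show 2 ^ u * (2 * e + 1) + 2 ^ u = 2 ^ u * (2 * e + 1 + 1) by ring,
        thueMorse_pow_mul, thueMorse_pow_mul, thueMorse_pow]
      omega

/-- The constraints on `r` and `r + s` expressed through the Thue–Morse sequence. -/
structure GapSystem (r s : ℕ) : Prop where
  even : Even r
  base_pos : 0 < r
  pos : 0 < s
  zero : thueMorse r = 1
  before (j : ℕ) (hj : j + 1 < r) (hs : j + 1 < s) :
    thueMorse (r + (j + 1)) - (thueMorse (j + 1) - thueMorse j) = 1 ∨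
      thueMorse (r + (j + 1)) - (thueMorse (j + 1) - thueMorse j) = -1
  meet (hs : s < r) : thueMorse (r + s) - (thueMorse s - thueMorse (s - 1)) = 1
  double (hs : 1 < s) (hr : s ≤ r) :
    thueMorse (r - s + 1) - thueMorse (r - s) = 0 ∨ thueMorse (r - s + 1) - thueMorse (r - s) = -2
  after (i : ℕ) (hi : s + i + 1 < r) :
    thueMorse (r + (s + i + 1)) - (thueMorse (s + i + 1) - thueMorse (s + i)) -
        (thueMorse (i + 1) - thueMorse i) = 1 ∨
      thueMorse (r + (s + i + 1)) - (thueMorse (s + i + 1) - thueMorse (s + i)) -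
        (thueMorse (i + 1) - thueMorse i) = -1

/-- `r + j` and `j` have the same Thue–Morse sign for `j < 2 ^ k`, and opposite signs for
`2 ^ k ≤ j < 3 * 2 ^ (k - 1)`; the sign at `r - 2 ^ k` is negative. -/
structure AgreesUpTo (r k : ℕ) : Prop where
  pos : 0 < k
  le : 3 * 2 ^ k ≤ 2 * r
  agree (j : ℕ) (hj : j < 2 ^ k) : thueMorse (r + j) = thueMorse j
  disagree (j : ℕ) (hj : 2 ^ k ≤ j) (hj' : 2 * j < 3 * 2 ^ k) :
    thueMorse (r + j) = -thueMorse j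
  sub : thueMorse (r - 2 ^ k) = -1

theorem agreesUpTo_of_one {v q : ℕ} (hv : 0 < v) (hq : 3 ≤ q) (ho : Odd q) (h : thueMorse q = 1)
    (h₁ : thueMorse (q + 1) = 1) : AgreesUpTo (2 ^ v * q) v := by
  refine ⟨hv, by nlinarith [Nat.two_pow_pos v], fun j hj => ?_, fun j hj hj' => ?_, ?_⟩
  · rw [thueMorse_pow_mul_add _ _ _ hj, h, one_mul]
  · obtain ⟨b, rfl⟩ := Nat.exists_eq_add_of_le hj
    rw [thueMorse_pow_add v b (by omega), ← add_assoc, ← Nat.mul_succ,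
      thueMorse_pow_mul_add _ _ _ (by omega), Nat.succ_eq_add_one, h₁]
    ring
  · obtain ⟨c, rfl⟩ := ho
    rw [thueMorse_two_mul_add_one] at h
    rw [mul_add_one, Nat.add_sub_cancel, thueMorse_pow_mul, thueMorse_two_mul]
    omega

theorem agreesUpTo_of_neg_one {v q : ℕ} (hq : 3 ≤ q) (ho : Odd q) (h : thueMorse q = 1)
    (h₁ : thueMorse (q + 1) = -1) :
    AgreesUpTo (2 ^ v * q) (v + 1) := by
  have hV : 0 < 2 ^ v := by positivity
  obtain ⟨h₂, hq4⟩ := thueMorse_add_two_of_odd ho (by rw [h₁, h])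
  rw [h] at h₂
  refine ⟨by omega, by rw [pow_succ]; nlinarith, fun j hj => ?_, fun j hj hj' => ?_, ?_⟩
  · by_cases hjv : j < 2 ^ v
    · rw [thueMorse_pow_mul_add _ _ _ hjv, h, one_mul]
    · obtain ⟨b, rfl⟩ := Nat.exists_eq_add_of_le (not_lt.mp hjv)
      rw [pow_succ] at hj
      rw [thueMorse_pow_add v b (by omega), ← add_assoc, ← Nat.mul_succ,
        thueMorse_pow_mul_add _ _ _ (by omega), Nat.succ_eq_add_one, h₁]
      ring
  · obtain ⟨b, rfl⟩ := Nat.exists_eq_add_of_le hj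
    rw [pow_succ] at hj'
    rw [thueMorse_pow_add (v + 1) b (by rw [pow_succ]; omega),
      show 2 ^ v * q + (2 ^ (v + 1) + b) = 2 ^ v * (q + 2) + b by ring,
      thueMorse_pow_mul_add _ _ _ (by omega), h₂]
    ring
  · obtain ⟨c, rfl⟩ : ∃ c, q = 2 * (2 * c + 1) + 1 := ⟨q / 4, by omega⟩
    rw [thueMorse_two_mul_add_one, thueMorse_two_mul_add_one] at h
    rw [show 2 ^ v * (2 * (2 * c + 1) + 1) = 2 ^ v * (2 * (2 * c) + 1) + 2 ^ (v + 1) by ring,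
      Nat.add_sub_cancel, thueMorse_pow_mul, thueMorse_two_mul_add_one, thueMorse_two_mul]
    omega

theorem GapSystem.start {r s : ℕ} (h : GapSystem r s) (hs : s + 1 < r)
    (hrs : thueMorse (r + s) = thueMorse s) : thueMorse s = -1 := by
  have hm := h.meet (by omega)
  have ha := h.after 0 (by omega)
  simp only [add_zero, zero_add, thueMorse_one, thueMorse_zero] at ha
  have e₁ := thueMorse_eq_one_or s
  have e₂ := thueMorse_eq_one_or (s - 1)
  have e₃ := thueMorse_eq_one_or (s + 1)
  have e₅ := thueMorse_eq_one_or (r + (s + 1))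
  have hp := h.pos
  rcases Nat.even_or_odd s with he | ho
  · have := thueMorse_succ_of_even he
    omega
  · have := thueMorse_succ_of_even (n := s - 1) (by
      obtain ⟨p, rfl⟩ := ho
      exact ⟨p, by omega⟩)
    rw [Nat.sub_add_cancel hp] at this
    omega

theorem AgreesUpTo.exists_eq {r k : ℕ} (h : AgreesUpTo r k) : ∃ M, 0 < M ∧ 2 ^ k = 2 * M := by
  obtain ⟨l, rfl⟩ := Nat.exists_eq_succ_of_ne_zero h.pos.ne'
  exact ⟨2 ^ l, by positivity, by rw [pow_succ]; ring⟩

theorem GapSystem.lt_two_pow {r s k : ℕ} (h : GapSystem r s) (ha : AgreesUpTo r k) :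
    s < 2 ^ k := by
  obtain ⟨M, hM, hk⟩ := ha.exists_eq
  have hle := ha.le
  obtain ⟨r', rfl⟩ := h.even.two_dvd
  have hL := thueMorse_pow k
  have hrL := ha.disagree (2 ^ k) le_rfl (by omega)
  have hL1 := thueMorse_succ_of_even (n := 2 ^ k) (by rw [hk]; exact even_two_mul M)
  have hrL1 := thueMorse_succ_of_even (n := 2 * r' + 2 ^ k)
    (by rw [hk, ← mul_add]; exact even_two_mul _)
  rw [add_assoc] at hrL1
  by_contra hs
  rcases (not_lt.mp hs).eq_or_lt with rfl | hlt
  · have hd := h.double (by omega) (by omega)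
    have hs := ha.sub
    have := thueMorse_succ_of_even (n := 2 * r' - 2 ^ k)
      (by rw [hk, ← Nat.mul_sub]; exact even_two_mul _)
    omega
  · rcases Nat.eq_or_lt_of_le hlt with rfl | hlt
    · have := h.meet (by simp only [Nat.succ_eq_add_one]; omega)
      simp only [Nat.succ_eq_add_one, Nat.add_sub_cancel] at this
      omega
    · have := h.before (2 ^ k) (by omega) hlt
      omega

theorem GapSystem.apply_add_two_mul {r s k : ℕ} (h : GapSystem r s) (ha : AgreesUpTo r k) (c : ℕ)
    (hc : s + 2 * c + 1 < 2 ^ k) : thueMorse (s + 2 * c) = -thueMorse c := by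
  have hle := ha.le
  have h₁ := h.after (2 * c) (by omega)
  rw [ha.agree _ hc, thueMorse_two_mul_add_one, thueMorse_two_mul] at h₁
  have e₁ := thueMorse_eq_one_or (s + 2 * c)
  have e₂ := thueMorse_eq_one_or c
  omega

theorem GapSystem.le_one {r s k : ℕ} (h : GapSystem r s) (ha : AgreesUpTo r k) : s ≤ 1 := by
  by_contra hs
  have hlt := h.lt_two_pow ha
  obtain ⟨M, hM, hk⟩ := ha.exists_eq
  have hle := ha.le
  have hs₁ := h.start (by omega) (ha.agree s hlt)
  have hL := thueMorse_pow k
  obtain ⟨p, rfl | rfl⟩ := Nat.even_or_odd' s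
  · by_cases hu : ∀ u ≤ k, 2 * p + 2 ^ u ≠ 2 ^ k
    · obtain ⟨c, hc, hne⟩ := exists_thueMorse_add_ne (by omega) hlt hu
      apply hne
      rw [hs₁, neg_one_mul]
      obtain ⟨d, rfl | rfl⟩ := Nat.even_or_odd' c
      · rw [thueMorse_two_mul, h.apply_add_two_mul ha d hc]
      · rw [← add_assoc, ← mul_add, thueMorse_two_mul_add_one, thueMorse_two_mul_add_one,
          ← thueMorse_two_mul, mul_add, h.apply_add_two_mul ha d (by omega)]
    · push Not at hu
      obtain ⟨u, huk, hu⟩ := hu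
      have hu1 : 1 < 2 ^ u := by
        have : 2 ^ u ≠ 1 := by omega
        have : 0 < 2 ^ u := by positivity
        omega
      have h₁ := h.after (2 ^ u) (by omega)
      have hL1 := ha.disagree (2 * p + 2 ^ u + 1) (by omega) (by omega)
      rw [hL1, hu, thueMorse_pow, thueMorse_pow, thueMorse_pow_add u 1 hu1,
        thueMorse_pow_add k 1 (by omega), thueMorse_one] at h₁
      omega
  · rw [thueMorse_two_mul_add_one] at hs₁
    obtain ⟨l, rfl⟩ := Nat.exists_eq_succ_of_ne_zero ha.pos.ne'
    rw [Nat.succ_eq_add_one, pow_succ] at hk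
    obtain rfl : M = 2 ^ l := by omega
    by_cases hu : ∀ u ≤ l, p + 2 ^ u ≠ 2 ^ l
    · obtain ⟨c, hc, hne⟩ := exists_thueMorse_add_ne (by omega) (by omega) hu
      apply hne
      have := h.apply_add_two_mul ha c (by rw [Nat.succ_eq_add_one, pow_succ]; omega)
      rw [show 2 * p + 1 + 2 * c = 2 * (p + c) + 1 by ring, thueMorse_two_mul_add_one] at this
      rw [show thueMorse p = 1 by omega, one_mul]
      omega
    · push Not at hu
      obtain ⟨u, hul, hu⟩ := hu
      rw [Nat.succ_eq_add_one, pow_succ] at *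
      have hu0 : 0 < 2 ^ u := by positivity
      rcases Nat.eq_or_lt_of_le hu0 with hu1 | hu1
      · have h₁ := h.after 1 (by omega)
        have hL1 := ha.disagree (2 ^ (l + 1) + 1) (by omega) (by rw [pow_succ]; omega)
        rw [show 2 * p + 1 + 1 + 1 = 2 ^ (l + 1) + 1 by rw [pow_succ]; omega,
          show 2 * p + 1 + 1 = 2 ^ (l + 1) by rw [pow_succ]; omega, hL1, thueMorse_pow,
          thueMorse_pow_add (l + 1) 1 (by rw [pow_succ]; omega), thueMorse_one] at h₁
        norm_num [thueMorse_two] at h₁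
      · have h₁ := h.after (2 ^ (u + 1)) (by rw [pow_succ]; omega)
        have hL1 := ha.disagree (2 ^ (l + 1) + 2) (by omega) (by rw [pow_succ]; omega)
        rw [show 2 * p + 1 + 2 ^ (u + 1) + 1 = 2 ^ (l + 1) + 2 by rw [pow_succ, pow_succ]; omega,
          show 2 * p + 1 + 2 ^ (u + 1) = 2 ^ (l + 1) + 1 by rw [pow_succ, pow_succ]; omega,
          hL1, thueMorse_pow,
          thueMorse_pow_add (l + 1) 1 (by rw [pow_succ]; omega),
          thueMorse_pow_add (l + 1) 2 (by rw [pow_succ]; omega),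
          thueMorse_pow_add (u + 1) 1 (by rw [pow_succ]; omega),
          thueMorse_one, thueMorse_two] at h₁
        omega

theorem GapSystem.exists_eq_two_pow_mul {r s : ℕ} (h : GapSystem r s) :
    ∃ v q, 0 < v ∧ 3 ≤ q ∧ Odd q ∧ thueMorse q = 1 ∧ r = 2 ^ v * q := by
  obtain ⟨v, q, hq, rfl⟩ := Nat.exists_eq_two_pow_mul_odd h.base_pos.ne'
  have hz := h.zero
  rw [thueMorse_pow_mul] at hz
  have hv : v ≠ 0 := by
    rintro rfl
    have he := h.even
    rw [pow_zero, one_mul] at he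
    exact (Nat.not_even_iff_odd.2 hq) he
  have hq3 : 3 ≤ q := by
    have : q ≠ 1 := by
      rintro rfl
      rw [thueMorse_one] at hz
      omega
    obtain ⟨e, rfl⟩ := hq
    omega
  exact ⟨v, q, Nat.pos_of_ne_zero hv, hq3, hq, hz, rfl⟩

theorem GapSystem.exists_two_pow_of_one {r : ℕ} (h : GapSystem r 1) : ∃ K, r + 2 = 2 ^ K := by
  have key (i : ℕ) (hi : i + 2 < r) :
      thueMorse (r + (i + 2)) - thueMorse (i + 2) + thueMorse i = 1 ∨
        thueMorse (r + (i + 2)) - thueMorse (i + 2) + thueMorse i = -1 := by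
    have := h.after i (by omega)
    rw [show 1 + i + 1 = i + 2 by omega, add_comm 1 i] at this
    omega
  have eq_two {k : ℕ} (ha : AgreesUpTo r k) : k = 2 := by
    have hle := ha.le
    have hpos := ha.pos
    rcases lt_trichotomy k 2 with hk | hk | hk
    · obtain rfl : k = 1 := by omega
      have := key 0 (by obtain ⟨a, rfl⟩ := h.even; omega)
      have h₂ := ha.disagree 2 (by norm_num) (by norm_num)
      simp only [zero_add, h₂, thueMorse_two, thueMorse_zero] at this
      omega
    · exact hk
    · have h8 : 2 ^ 3 ≤ 2 ^ k := Nat.pow_le_pow_right (by norm_num) hk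
      have := key (2 ^ k) (by omega)
      rw [ha.disagree _ (by omega) (by omega), thueMorse_pow_add k 2 (by omega), thueMorse_pow,
        thueMorse_two] at this
      omega
  obtain ⟨v, q, hv, hq3, hq, hz, rfl⟩ := h.exists_eq_two_pow_mul
  rcases thueMorse_eq_one_or (q + 1) with h₁ | h₁
  · obtain rfl := eq_two (agreesUpTo_of_one hv hq3 hq hz h₁)
    have h₂ := key 4 (by omega)
    rw [show 2 ^ 2 * q + (4 + 2) = 2 ^ 2 * (q + 1) + 2 by ring,
      thueMorse_pow_mul_add _ _ _ (by norm_num), h₁, thueMorse_two,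
      show thueMorse 4 = -1 from thueMorse_pow 2,
      show thueMorse (4 + 2) = -thueMorse 2 from thueMorse_pow_add 2 2 (by norm_num),
      thueMorse_two] at h₂
    omega
  · obtain rfl : v = 1 := by
      have := eq_two (agreesUpTo_of_neg_one (v := v) hq3 hq hz h₁)
      omega
    have hq4 := (thueMorse_add_two_of_odd hq (by rw [h₁, hz])).2
    obtain ⟨w, g, hg, hqg⟩ := Nat.exists_eq_two_pow_mul_odd (Nat.succ_ne_zero q)
    rw [Nat.succ_eq_add_one] at hqg
    refine ⟨w + 1, ?_⟩
    suffices hg1 : g = 1 by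
      rw [hg1] at hqg
      rw [pow_succ]
      omega
    by_contra hg1
    have hg3 : 3 ≤ g := by
      obtain ⟨e, rfl⟩ := hg
      omega
    have hw : 8 ≤ 2 ^ (w + 1) := by
      rcases w with - | - | w
      · obtain ⟨e, rfl⟩ := hg
        omega
      · obtain ⟨e, rfl⟩ := hg
        omega
      · have := Nat.two_pow_pos w
        rw [pow_succ, pow_succ, pow_succ]
        omega
    have hr : 2 ^ 1 * q + 2 = 2 ^ (w + 1) * g := by
      rw [show 2 ^ (w + 1) * g = 2 * (2 ^ w * g) by ring, ← hqg]
      ring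
    have hr3 : 3 * 2 ^ (w + 1) ≤ 2 ^ (w + 1) * g := by nlinarith
    have hneg : thueMorse g = -1 := by rw [← h₁, hqg, thueMorse_pow_mul]
    have k₁ := key (2 ^ (w + 1)) (by omega)
    rw [show 2 ^ 1 * q + (2 ^ (w + 1) + 2) = 2 ^ (w + 1) * (g + 1) by
        rw [mul_add, ← hr]; ring,
      thueMorse_pow_mul, thueMorse_pow_add (w + 1) 2 (by omega), thueMorse_pow,
      thueMorse_two] at k₁
    have k₂ := key (2 ^ (w + 1 + 1)) (by rw [pow_succ]; omega)
    rw [show 2 ^ 1 * q + (2 ^ (w + 1 + 1) + 2) = 2 ^ (w + 1) * (g + 2) by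
        rw [mul_add, ← hr]; ring,
      thueMorse_pow_mul, thueMorse_pow_add (w + 1 + 1) 2 (by rw [pow_succ]; omega),
      thueMorse_pow, thueMorse_two] at k₂
    have e₁ := thueMorse_eq_one_or (g + 1)
    have e₂ := thueMorse_eq_one_or (g + 2)
    have e₃ := (thueMorse_add_two_of_odd hg (by omega)).1
    omega

theorem GapSystem.exists_two_pow {r s : ℕ} (h : GapSystem r s) : ∃ K, r + s + 1 = 2 ^ K := by
  obtain ⟨v, q, hv, hq3, hq, hz, hr⟩ := h.exists_eq_two_pow_mul
  obtain ⟨k, ha⟩ : ∃ k, AgreesUpTo r k := by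
    rw [hr]
    rcases thueMorse_eq_one_or (q + 1) with h₁ | h₁
    · exact ⟨_, agreesUpTo_of_one hv hq3 hq hz h₁⟩
    · exact ⟨_, agreesUpTo_of_neg_one hq3 hq hz h₁⟩
  obtain rfl : s = 1 := le_antisymm (h.le_one ha) h.pos
  exact h.exists_two_pow_of_one

section

open Finset.HasAntidiagonal (antidiagonal mem_antidiagonal)

theorem R_eq_card (S : Set ℕ) [DecidablePred (· ∈ S)] (n : ℕ) :
    R S n = ((antidiagonal n).filter
      fun p => p.1 < p.2 ∧ p.1 ∈ S ∧ p.2 ∈ S).card := by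
  rw [R, ← Set.ncard_coe_finset]
  congr 1
  ext p
  simp only [Set.mem_ofPred_eq, Finset.coe_filter, mem_antidiagonal]
  tauto

theorem sum_antidiagonal_indicator (S : Set ℕ) [DecidablePred (· ∈ S)] (n : ℕ) :
    ∑ p ∈ antidiagonal n, (if p.1 ∈ S then (1 : ℤ) else 0) * (if p.2 ∈ S then 1 else 0) =
      2 * R S n + if Even n then (if n / 2 ∈ S then 1 else 0) else 0 := by
  set c : ℕ → ℤ := fun k => if k ∈ S then 1 else 0 with hc
  have hlt : ∑ p ∈ antidiagonal n, (if p.1 < p.2 then c p.1 * c p.2 else 0) = R S n := by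
    rw [R_eq_card, Finset.card_filter, Nat.cast_sum]
    refine Finset.sum_congr rfl fun p _ => ?_
    simp only [hc]
    split_ifs <;> simp_all
  have hgt : ∑ p ∈ antidiagonal n, (if p.2 < p.1 then c p.1 * c p.2 else 0) = R S n := by
    rw [← hlt, ← Finset.Nat.sum_antidiagonal_swap]
    refine Finset.sum_congr rfl fun p _ => ?_
    simp only [Prod.fst_swap, Prod.snd_swap, mul_comm]
  have heq : ∑ p ∈ antidiagonal n, (if p.1 = p.2 then c p.1 * c p.2 else 0) =
      if Even n then c (n / 2) else 0 := by
    split_ifs with he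
    · rw [Finset.sum_eq_single (n / 2, n / 2)]
      · simp [hc]
      · rintro ⟨a, b⟩ hab hne
        rw [mem_antidiagonal] at hab
        refine if_neg fun e => hne ?_
        simp only [Prod.mk.injEq] at hab e ⊢
        omega
      · intro hn
        obtain ⟨a, rfl⟩ := he
        exact absurd (mem_antidiagonal.2 (by simp only; omega)) hn
    · refine Finset.sum_eq_zero fun p hp => if_neg fun e => he ?_
      rw [mem_antidiagonal] at hp
      exact ⟨p.1, by omega⟩
  change ∑ p ∈ antidiagonal n, c p.1 * c p.2 = 2 * R S n + if Even n then c (n / 2) else 0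
  rw [← heq, two_mul]
  nth_rewrite 1 [← hlt]
  rw [← hgt, ← Finset.sum_add_distrib, ← Finset.sum_add_distrib]
  refine Finset.sum_congr rfl fun p _ => ?_
  rcases lt_trichotomy p.1 p.2 with hp | hp | hp
  · simp [hp, hp.ne, hp.not_gt]
  · simp [hp]
  · simp [hp, hp.ne', hp.not_gt]

theorem sum_antidiagonal_mul_ite (f : ℕ → ℤ) (r n : ℕ) :
    ∑ p ∈ antidiagonal n, f p.1 * (if p.2 = r then 1 else 0) =
      if r ≤ n then f (n - r) else 0 := by
  simp only [mul_ite, mul_one, mul_zero]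
  split_ifs with hr
  · rw [Finset.sum_eq_single (n - r, r)]
    · simp
    · rintro ⟨a, b⟩ hab hne
      rw [mem_antidiagonal] at hab
      refine if_neg fun e => hne ?_
      simp only [Prod.mk.injEq] at hab e ⊢
      omega
    · intro hn
      exact absurd (mem_antidiagonal.2 (by simp only; omega)) hn
  · refine Finset.sum_eq_zero fun p hp => if_neg fun e => hr ?_
    rw [mem_antidiagonal] at hp
    omega

/-- A sequence whose generating function satisfies
`f(x) * (1 / (1 - x) + x ^ r₁ + x ^ r₂) = f(x ^ 2)` up to degree `m`. -/
def SatisfiesRecurrence (f : ℕ → ℤ) (r₁ r₂ m : ℕ) : Prop :=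
  ∀ n ≤ m, ∑ a ∈ Finset.range (n + 1), f a + (if r₁ ≤ n then f (n - r₁) else 0) +
    (if r₂ ≤ n then f (n - r₂) else 0) = if Even n then f (n / 2) else 0

theorem satisfiesRecurrence_of_R_eq {r₁ r₂ m : ℕ} {C D : Set ℕ} [DecidablePred (· ∈ C)]
    [DecidablePred (· ∈ D)] (h₂ : r₁ < r₂)
    (hU : C ∪ D = Set.Icc 0 m) (hI : C ∩ D = {r₁, r₂}) (hR : ∀ n ≤ m, R C n = R D n) :
    SatisfiesRecurrence
      (fun n => (if n ∈ C then 1 else 0) - (if n ∈ D then 1 else 0)) r₁ r₂ m := by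
  intro n hn
  have hC := sum_antidiagonal_indicator C n
  have hD := sum_antidiagonal_indicator D n
  rw [hR n hn] at hC
  set c : ℕ → ℤ := fun k => if k ∈ C then 1 else 0 with hc
  set d : ℕ → ℤ := fun k => if k ∈ D then 1 else 0 with hd
  have hadd (k : ℕ) (hk : k ≤ m) :
      c k + d k = 1 + (if k = r₁ then 1 else 0) + (if k = r₂ then 1 else 0) := by
    have hu : k ∈ C ∪ D := by rw [hU]; exact ⟨k.zero_le, hk⟩
    have hi : k ∈ C ∩ D ↔ k = r₁ ∨ k = r₂ := by rw [hI]; simp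
    simp only [Set.mem_union, Set.mem_inter_iff] at hu hi
    simp only [hc, hd]
    split_ifs <;> first | omega | simp_all
  have hsum : ∑ p ∈ antidiagonal n, (c p.1 * c p.2 - d p.1 * d p.2) =
      ∑ p ∈ antidiagonal n, (c p.1 - d p.1) * (c p.2 + d p.2) := by
    have hs := Finset.Nat.sum_antidiagonal_swap (n := n) (f := fun p : ℕ × ℕ => c p.1 * d p.2)
    simp only [Prod.fst_swap, Prod.snd_swap] at hs
    rw [← sub_eq_zero, ← Finset.sum_sub_distrib, ← sub_eq_zero.2 hs, ← Finset.sum_sub_distrib]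
    exact Finset.sum_congr rfl fun p _ => by ring
  have hexp : ∑ p ∈ antidiagonal n, (c p.1 - d p.1) * (c p.2 + d p.2) =
      ∑ p ∈ antidiagonal n, ((c p.1 - d p.1) +
        (c p.1 - d p.1) * (if p.2 = r₁ then 1 else 0) +
        (c p.1 - d p.1) * (if p.2 = r₂ then 1 else 0)) := by
    refine Finset.sum_congr rfl fun p hp => ?_
    rw [mem_antidiagonal] at hp
    rw [hadd p.2 (by omega)]
    ring
  rw [Finset.sum_add_distrib, Finset.sum_add_distrib,
    sum_antidiagonal_mul_ite (fun k => c k - d k), sum_antidiagonal_mul_ite (fun k => c k - d k),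
    Finset.Nat.sum_antidiagonal_eq_sum_range_succ_mk (fun p : ℕ × ℕ => c p.1 - d p.1)] at hexp
  change ∑ a ∈ Finset.range (n + 1), (c a - d a) + (if r₁ ≤ n then c (n - r₁) - d (n - r₁) else 0) +
    (if r₂ ≤ n then c (n - r₂) - d (n - r₂) else 0) = if Even n then c (n / 2) - d (n / 2) else 0
  change ∑ p ∈ antidiagonal n, c p.1 * c p.2 =
    2 * R D n + if Even n then c (n / 2) else 0 at hC
  change ∑ p ∈ antidiagonal n, d p.1 * d p.2 =
    2 * R D n + if Even n then d (n / 2) else 0 at hD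
  rw [Finset.sum_sub_distrib, hexp, hC, hD] at hsum
  simp only [] at hsum
  rw [← hsum]
  split_ifs <;> ring

end

theorem SatisfiesRecurrence.gapSystem {f : ℕ → ℤ} {r₁ r₂ m : ℕ}
    (hf : SatisfiesRecurrence f r₁ r₂ m) (h₁ : 0 < r₁) (h₂ : r₁ < r₂) (hm : r₁ + r₂ ≤ m)
    (he : Even r₁) (h0 : f 0 = 1) (hf₁ : f r₁ = 0) (hf₂ : f r₂ = 0)
    (hone : ∀ n ≤ m, n ≠ r₁ → n ≠ r₂ → f n = 1 ∨ f n = -1) : GapSystem r₁ (r₂ - r₁) := by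
  obtain ⟨s, rfl⟩ := Nat.exists_eq_add_of_lt h₂
  rw [show r₁ + s + 1 - r₁ = s + 1 by omega]
  let step (r n : ℕ) : ℤ := (if r ≤ n + 1 then f (n + 1 - r) else 0) - if r ≤ n then f (n - r) else 0
  have step_lt (r n : ℕ) (h : n + 1 < r) : step r n = 0 := by
    simp only [step]
    rw [if_neg (by omega), if_neg (by omega), sub_zero]
  have step_eq (n : ℕ) : step (n + 1) n = 1 := by simp [step, h0]
  have step_add (r j : ℕ) : step r (r + j) = f (j + 1) - f j := by
    simp only [step]
    rw [if_pos (by omega), if_pos (by omega), show r + j + 1 - r = j + 1 by omega,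
      Nat.add_sub_cancel_left]
  have hrec (n : ℕ) (hn : n + 1 ≤ m) : f (n + 1) + step r₁ n + step (r₁ + s + 1) n =
      if Even (n + 1) then f ((n + 1) / 2) else -f ((n + 1) / 2) := by
    have e₁ := hf (n + 1) hn
    have e₂ := hf n (by omega)
    rw [Finset.sum_range_succ] at e₁
    simp only [step]
    by_cases hev : Even n
    · have hodd : ¬Even (n + 1) := by simpa [Nat.even_add_one] using hev
      rw [if_pos hev] at e₂
      rw [if_neg hodd] at e₁ ⊢
      obtain ⟨a, rfl⟩ := hev
      rw [show (a + a + 1) / 2 = (a + a) / 2 by omega]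
      linarith
    · have heven : Even (n + 1) := by simpa [Nat.even_add_one] using hev
      rw [if_neg hev] at e₂
      rw [if_pos heven] at e₁ ⊢
      linarith
  have half (n : ℕ) (hlt : ∀ k ≤ n / 2, f k = thueMorse k) :
      (if Even n then f (n / 2) else -f (n / 2)) = thueMorse n := by
    rw [hlt _ le_rfl]
    obtain ⟨a, rfl | rfl⟩ := Nat.even_or_odd' n
    · simp [thueMorse_two_mul]
    · rw [if_neg (by simp), thueMorse_two_mul_add_one, show (2 * a + 1) / 2 = a by omega]
  have hlow (n : ℕ) (hn : n < r₁) : f n = thueMorse n := by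
    induction n using Nat.strong_induction_on with
    | _ n ih =>
      rcases n with - | n
      · rw [h0, thueMorse_zero]
      · have := hrec n (by omega)
        rwa [step_lt _ _ hn, step_lt _ _ (by omega), add_zero, add_zero,
          half _ fun k hk => ih k (by omega) (by omega)] at this
  have hrec' (n : ℕ) (hn : n + 1 < 2 * r₁) :
      f (n + 1) + step r₁ n + step (r₁ + s + 1) n = thueMorse (n + 1) := by
    rw [hrec n (by omega), half _ fun k hk => hlow k (by omega)]
  have hzero : thueMorse r₁ = 1 := by
    obtain ⟨p, rfl⟩ := Nat.exists_eq_succ_of_ne_zero h₁.ne'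
    have := hrec' p (by omega)
    rw [step_eq, step_lt _ _ (by omega), hf₁] at this
    rw [← this]
    norm_num
  have hbefore (j : ℕ) (hj : j + 1 < r₁) (hs : j < s) :
      f (r₁ + j + 1) + (thueMorse (j + 1) - thueMorse j) = thueMorse (r₁ + j + 1) := by
    have := hrec' (r₁ + j) (by omega)
    rwa [step_add, step_lt _ _ (by omega), hlow _ hj, hlow j (by omega), add_zero] at this
  refine ⟨he, h₁, by omega, hzero, fun j hj hs => ?_, fun hs => ?_, fun hs hr => ?_, fun i hi => ?_⟩
  · have := hbefore j hj (by omega)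
    have := hone (r₁ + j + 1) (by omega) (by omega) (by omega)
    rw [← add_assoc]
    omega
  · have := hrec' (r₁ + s) (by omega)
    rw [step_add, step_eq, hlow _ hs, hlow s (by omega), hf₂] at this
    rw [Nat.add_sub_cancel, ← add_assoc]
    omega
  · have e₁ := hbefore 0 (by omega) (by omega)
    have e₂ := hrec (r₁ + r₁) (by omega)
    rw [if_neg (by simp [Nat.even_add_one]), step_add, show (r₁ + r₁ + 1) / 2 = r₁ by omega] at e₂
    have e₃ := step_add (r₁ + s + 1) (r₁ - (s + 1))
    rw [show r₁ + s + 1 + (r₁ - (s + 1)) = r₁ + r₁ by omega, hlow _ (by omega),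
      hlow _ (by omega)] at e₃
    have e₄ := hone (r₁ + r₁ + 1) (by omega) (by omega) (by omega)
    have e₅ := thueMorse_succ_of_even he
    rw [add_zero, zero_add, thueMorse_one, thueMorse_zero] at e₁
    omega
  · have := hrec' (r₁ + s + 1 + i) (by omega)
    have e := hone (r₁ + s + 1 + i + 1) (by omega) (by omega) (by omega)
    rw [step_add, show r₁ + s + 1 + i = r₁ + (s + 1 + i) by ring, step_add, hlow _ hi,
      hlow (s + 1 + i) (by omega), hlow (i + 1) (by omega), hlow i (by omega)] at this
    rw [show r₁ + s + 1 + i = r₁ + (s + 1 + i) by ring] at e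
    rw [← add_assoc r₁]
    omega

theorem stmt_11 (r₁ r₂ m : ℕ) (h₁ : 0 < r₁) (h₂ : r₁ < r₂) (h₃ : r₂ < r₁ + r₂)
    (h₄ : r₁ + r₂ ≤ m) (h₅ : Even r₁) (C D : Set ℕ)
    (hU : C ∪ D = Set.Icc 0 m) (hI : C ∩ D = {r₁, r₂}) (h0 : 0 ∈ C)
    (hR : ∀ n ≤ m, R C n = R D n) :
    r₂ = 2 ^ Nat.clog 2 r₂ - 1 ∧ ∃ k : ℕ, r₂ + 1 = 2 ^ k := by
  classical
  have hmem (n : ℕ) (hn : n ≤ m) : n ∈ C ∨ n ∈ D := by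
    have : n ∈ C ∪ D := by rw [hU]; exact ⟨n.zero_le, hn⟩
    exact this
  have hboth (n : ℕ) : n ∈ C ∧ n ∈ D ↔ n = r₁ ∨ n = r₂ := by
    rw [← Set.mem_inter_iff, hI]
    simp
  have hr₁ := (hboth r₁).2 (Or.inl rfl)
  have hr₂ := (hboth r₂).2 (Or.inr rfl)
  have h0D : 0 ∉ D := fun h => by
    have := (hboth 0).1 ⟨h0, h⟩
    omega
  have hgap := (satisfiesRecurrence_of_R_eq h₂ hU hI hR).gapSystem h₁ h₂ h₄ h₅
    (by simp [h0, h0D]) (by simp [hr₁]) (by simp [hr₂]) fun n hn hn₁ hn₂ => by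
      have := hmem n hn
      have := (hboth n).not.2 (by tauto)
      by_cases hC : n ∈ C <;> by_cases hD : n ∈ D <;> simp_all
  obtain ⟨K, hK⟩ := hgap.exists_two_pow
  rw [show r₁ + (r₂ - r₁) + 1 = r₂ + 1 by omega] at hK
  refine ⟨?_, K, hK⟩
  have hclog : Nat.clog 2 r₂ = K := by
    rcases K with - | K
    · omega
    rw [pow_succ] at hK
    refine le_antisymm (Nat.clog_le_of_le_pow (by rw [pow_succ]; omega)) ?_
    exact (Nat.lt_clog_iff_pow_lt (by norm_num)).2 (by omega)
  rw [hclog]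
  omega
end

section
/- Let r₁, r₂, m be integers with 0 < r₁ < r₂ < r₁ + r₂ ≤ m and r₁ even. Let C and D be sets of nonnegative integers such that C ∪ D = [0, m], C ∩ D = {r₁, r₂}, and 0 ∈ C. If R_C(n) = R_D(n) for every integer n ∈ [0, m], then r₁/2 ∈ C; consequently the binary representation of r₁/2 contains an even number of digits 1. -/
open Finset in
/-- Ordered representations of `n` as a sum of two elements of `S` are counted twice by `R`,
except for the diagonal one. -/
lemma sum_antidiagonal_indicator_mul (S : Set ℕ) (n : ℕ) :
    ∑ p ∈ antidiagonal n, S.indicator (1 : ℕ → ℤ) p.1 * S.indicator (1 : ℕ → ℤ) p.2 =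
      2 * R S n + if Even n then S.indicator (1 : ℕ → ℤ) (n / 2) else 0 := by
  classical
  set c := S.indicator (1 : ℕ → ℤ) with hc
  have h_lt : ∑ p ∈ antidiagonal n, (if p.1 < p.2 then c p.1 * c p.2 else 0) = R S n := by
    have hset : {p : ℕ × ℕ | p.1 ∈ S ∧ p.2 ∈ S ∧ p.1 < p.2 ∧ p.1 + p.2 = n} =
        ((antidiagonal n).filter fun p => p.1 < p.2 ∧ p.1 ∈ S ∧ p.2 ∈ S : Finset (ℕ × ℕ)) := by
      ext p
      simp only [Set.mem_ofPred_eq, coe_filter, HasAntidiagonal.mem_antidiagonal]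
      tauto
    rw [R, hset, Set.ncard_coe_finset, card_filter]
    push_cast
    refine sum_congr rfl fun p _ => ?_
    by_cases h1 : p.1 ∈ S <;> by_cases h2 : p.2 ∈ S <;> simp [hc, h1, h2]
  have h_gt : ∑ p ∈ antidiagonal n, (if p.2 < p.1 then c p.1 * c p.2 else 0) = R S n := by
    rw [← h_lt, ← Nat.sum_antidiagonal_swap]
    exact sum_congr rfl fun p _ => by simp [mul_comm]
  have h_eq : ∑ p ∈ antidiagonal n, (if p.1 = p.2 then c p.1 * c p.2 else 0) =
      if Even n then c (n / 2) else 0 := by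
    have hsq (i : ℕ) : c i * c i = c i := by by_cases h : i ∈ S <;> simp [hc, h]
    split_ifs with hn
    · obtain ⟨k, rfl⟩ := hn
      rw [sum_eq_single (k, k)]
      · simp [hsq, ← two_mul]
      · rintro ⟨a, b⟩ hab hne
        rw [HasAntidiagonal.mem_antidiagonal] at hab
        refine if_neg fun h => hne ?_
        ext <;> simp only at * <;> omega
      · simp
    · refine sum_eq_zero fun p hp => if_neg fun h => hn ?_
      rw [HasAntidiagonal.mem_antidiagonal] at hp
      exact ⟨p.1, by omega⟩
  rw [two_mul, ← h_eq]
  nth_rw 1 [← h_lt]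
  rw [← h_gt, ← sum_add_distrib, ← sum_add_distrib]
  refine sum_congr rfl fun p _ => ?_
  rcases lt_trichotomy p.1 p.2 with h | h | h
  · simp [h, h.not_gt, h.ne]
  · simp [h]
  · simp [h, h.not_gt, h.ne']

open Finset in
/-- The coefficient form of `(C - D) (C + D) = C(x²) - D(x²)`. -/
lemma sum_indicator_sub_mul_indicator_add {C D : Set ℕ} {n : ℕ} (h : R C n = R D n) :
    ∑ k ∈ range (n + 1), (C.indicator (1 : ℕ → ℤ) k - D.indicator 1 k) *
        (C.indicator (1 : ℕ → ℤ) (n - k) + D.indicator 1 (n - k)) =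
      if Even n then C.indicator (1 : ℕ → ℤ) (n / 2) - D.indicator 1 (n / 2) else 0 := by
  have hC := sum_antidiagonal_indicator_mul C n
  have hD := sum_antidiagonal_indicator_mul D n
  rw [← Nat.succ_eq_add_one, ← Nat.sum_antidiagonal_eq_sum_range_succ (fun i j =>
    (C.indicator (1 : ℕ → ℤ) i - D.indicator 1 i) * (C.indicator (1 : ℕ → ℤ) j + D.indicator 1 j))]
  have hswap : ∑ p ∈ antidiagonal n, C.indicator (1 : ℕ → ℤ) p.1 * D.indicator (1 : ℕ → ℤ) p.2 =
      ∑ p ∈ antidiagonal n, D.indicator (1 : ℕ → ℤ) p.1 * C.indicator (1 : ℕ → ℤ) p.2 := by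
    rw [← Nat.sum_antidiagonal_swap]
    exact sum_congr rfl fun p _ => by simp [mul_comm]
  simp only [sub_mul, mul_add, sum_sub_distrib, sum_add_distrib]
  rw [hC, hD, hswap, h]
  split_ifs <;> ring

open Finset in
/-- A sequence starting at `1` whose partial sums vanish at odd positions and reproduce the
sequence at even positions is the Thue–Morse sequence. -/
lemma eq_neg_one_pow_sum_digits {f : ℕ → ℤ} {r : ℕ} (h0 : f 0 = 1)
    (hf : ∀ n < r, ∑ k ∈ range (n + 1), f k = if Even n then f (n / 2) else 0) :
    ∀ n < r, f n = (-1) ^ (Nat.digits 2 n).sum := by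
  have h_even (k : ℕ) (hk : 2 * k < r) : f (2 * k) = f k := by
    rcases k with _ | k
    · rfl
    · have h1 := hf (2 * (k + 1)) hk
      have h2 := hf (2 * k + 1) (by omega)
      rw [if_neg (by simp)] at h2
      rw [sum_range_succ, show 2 * (k + 1) = 2 * k + 1 + 1 by ring, h2, if_pos ⟨k + 1, by ring⟩,
        show (2 * k + 1 + 1) / 2 = k + 1 by omega] at h1
      simpa [mul_add] using h1
  intro n
  induction n using Nat.strong_induction_on with
  | _ n ih =>
    intro hn
    rcases Nat.even_or_odd' n with ⟨k, rfl | rfl⟩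
    · rcases Nat.eq_zero_or_pos k with rfl | hk
      · simpa using h0
      · rw [h_even k hn, ih k (by omega) (by omega),
          Nat.digits_def' (n := 2 * k) (by norm_num) (by omega)]
        simp
    · have h1 := hf (2 * k + 1) hn
      have h2 := hf (2 * k) (by omega)
      rw [if_neg (by simp), sum_range_succ, h2, if_pos (by simp),
        Nat.mul_div_cancel_left _ two_pos] at h1
      have h3 : f k = (-1) ^ (Nat.digits 2 k).sum := by
        rcases Nat.eq_zero_or_pos k with rfl | hk
        · simpa using h0
        · exact ih k (by omega) (by omega)
      rw [Nat.digits_def' (by norm_num) (by omega)]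
      simp only [List.sum_cons, show (2 * k + 1) % 2 = 1 by omega,
        show (2 * k + 1) / 2 = k by omega, pow_add, ← h3]
      linarith

theorem stmt_12 (r₁ r₂ m : ℕ) (h₁ : 0 < r₁) (h₂ : r₁ < r₂) (h₃ : r₂ < r₁ + r₂)
    (h₄ : r₁ + r₂ ≤ m) (h₅ : Even r₁) (C D : Set ℕ)
    (hU : C ∪ D = Set.Icc 0 m) (hI : C ∩ D = {r₁, r₂}) (h0 : 0 ∈ C)
    (hR : ∀ n ≤ m, R C n = R D n) :
    r₁ / 2 ∈ C ∧ Even ((Nat.digits 2 (r₁ / 2)).sum) := by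
  have hmU (i : ℕ) : i ∈ C ∨ i ∈ D ↔ i ≤ m := by simpa using Set.ext_iff.1 hU i
  have hmI (i : ℕ) : i ∈ C ∧ i ∈ D ↔ i = r₁ ∨ i = r₂ := by simpa using Set.ext_iff.1 hI i
  set f : ℕ → ℤ := fun i => C.indicator 1 i - D.indicator 1 i with hf
  have h_add (i : ℕ) (hi : i < r₁) :
      C.indicator (1 : ℕ → ℤ) i + D.indicator 1 i = 1 := by
    have hu := (hmU i).2 (by omega)
    have hi := mt (hmI i).1 (by omega)
    by_cases hC : i ∈ C <;> by_cases hD : i ∈ D <;> simp_all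
  have hr₁ := (hmI r₁).2 (Or.inl rfl)
  have hfr₁ : f r₁ = 0 := by simp [hf, hr₁.1, hr₁.2]
  have hf0 : f 0 = 1 := by
    have h0D : 0 ∉ D := fun h => by have := (hmI 0).1 ⟨h0, h⟩; omega
    simp [hf, h0, h0D]
  have h_sum (n : ℕ) (hn : n < r₁) :
      ∑ k ∈ Finset.range (n + 1), f k = if Even n then f (n / 2) else 0 := by
    rw [← sum_indicator_sub_mul_indicator_add (hR n (by omega))]
    refine Finset.sum_congr rfl fun k _ => ?_
    rw [h_add (n - k) (by omega), mul_one]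
  have h_half : f (r₁ / 2) = 1 := by
    have h := sum_indicator_sub_mul_indicator_add (hR r₁ (by omega))
    have h' : ∑ k ∈ Finset.range r₁, f k = 0 := by
      have := h_sum (r₁ - 1) (by omega)
      rwa [Nat.sub_add_cancel h₁, if_neg] at this
      grind
    have h_tail : ∑ k ∈ Finset.range r₁, f (k + 1) *
        (C.indicator (1 : ℕ → ℤ) (r₁ - (k + 1)) + D.indicator 1 (r₁ - (k + 1))) =
        ∑ k ∈ Finset.range r₁, f (k + 1) :=
      Finset.sum_congr rfl fun k _ => by rw [h_add _ (by omega), mul_one]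
    have h_shift := Finset.sum_range_succ' f r₁
    rw [Finset.sum_range_succ, h', hfr₁, hf0] at h_shift
    have h_zero : f 0 * (C.indicator (1 : ℕ → ℤ) (r₁ - 0) + D.indicator 1 (r₁ - 0)) = 2 := by
      simp [hf0, hr₁.1, hr₁.2]
    rw [if_pos h₅, Finset.sum_range_succ'] at h
    change _ = f (r₁ / 2) at h
    rw [← h]
    linarith
  constructor
  · by_contra hC
    by_cases hD : r₁ / 2 ∈ D <;> simp [hf, hC, hD] at h_half
  · rw [eq_neg_one_pow_sum_digits hf0 h_sum _ (by omega)] at h_half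
    rwa [neg_one_pow_eq_one_iff_even (by norm_num)] at h_half
end

section
/- Fix a positive integer l. Define C₀ = {0}, D₀ = {1}, and recursively C_i = C_{i−1} ∪ (2^i + D_{i−1}) and D_i = D_{i−1} ∪ (2^i + C_{i−1}) for 1 ≤ i ≤ 2l. Then R_{C_{2l}}(n) = R_{D_{2l}}(n) for all n ∈ ℕ, the sets C_{2l} and D_{2l} partition the interval [0, 2^(2l+1) − 1], and both 0 and 2^(2l+1) − 2 belong to C_{2l}. -/
/-- The pair of sets `(C_i, D_i)` with `C_i = C_{i-1} ∪ (2^i + D_{i-1})`,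
`D_i = D_{i-1} ∪ (2^i + C_{i-1})`, starting from `({0}, {1})`. -/
def CDseq2 : ℕ → Set ℕ × Set ℕ
  | 0 => ({0}, {1})
  | i + 1 =>
    ((CDseq2 i).1 ∪ (fun x => 2 ^ (i + 1) + x) '' (CDseq2 i).2,
     (CDseq2 i).2 ∪ (fun x => 2 ^ (i + 1) + x) '' (CDseq2 i).1)

/-- The pairs counted by `R (A ∪ (k + B)) n` when `A` and `B` lie below `k`, sorted by whether
neither, only the larger, or both of the summands are shifted. -/
theorem R_union_shift {A B : Set ℕ} {k : ℕ} (hA : ∀ a ∈ A, a < k) (n : ℕ) :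
    R (A ∪ (fun x => k + x) '' B) n =
      R A n + {q : ℕ × ℕ | q.1 ∈ A ∧ q.2 ∈ B ∧ q.1 + q.2 + k = n}.ncard +
        (if 2 * k ≤ n then R B (n - 2 * k) else 0) := by
  set P : Set (ℕ × ℕ) := {p | p.1 ∈ A ∧ p.2 ∈ A ∧ p.1 < p.2 ∧ p.1 + p.2 = n} with hP
  set X : Set (ℕ × ℕ) := {q | q.1 ∈ A ∧ q.2 ∈ B ∧ q.1 + q.2 + k = n} with hX
  set Y : Set (ℕ × ℕ) := {q | q.1 ∈ B ∧ q.2 ∈ B ∧ q.1 < q.2 ∧ q.1 + q.2 + 2 * k = n} with hY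
  have fin_of : ∀ S : Set (ℕ × ℕ), (∀ p ∈ S, p.1 + p.2 ≤ n) → S.Finite := fun S h =>
    (Set.finite_Iic (n, n)).subset fun p hp => by
      have := h p hp
      exact Prod.mk_le_mk.2 ⟨by omega, by omega⟩
  have hPf : P.Finite := fin_of P fun p hp => hp.2.2.2.le
  have hXf : X.Finite := fin_of X fun p hp => by have := hp.2.2; omega
  have hYf : Y.Finite := fin_of Y fun p hp => by have := hp.2.2.2; omega
  let f : ℕ × ℕ → ℕ × ℕ := fun q => (q.1, k + q.2)
  let g : ℕ × ℕ → ℕ × ℕ := fun q => (k + q.1, k + q.2)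
  have hf : f.Injective := by
    rintro ⟨a, b⟩ ⟨c, d⟩ h
    simpa [f] using h
  have hg : g.Injective := by
    rintro ⟨a, b⟩ ⟨c, d⟩ h
    simpa [g] using h
  have hset : {p : ℕ × ℕ | p.1 ∈ A ∪ (fun x => k + x) '' B ∧ p.2 ∈ A ∪ (fun x => k + x) '' B ∧
      p.1 < p.2 ∧ p.1 + p.2 = n} = P ∪ f '' X ∪ g '' Y := by
    ext ⟨a, b⟩
    constructor
    · rintro ⟨ha | ⟨x, hx, rfl⟩, hb | ⟨y, hy, rfl⟩, hlt, hs⟩ <;> dsimp only at *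
      · exact Or.inl (Or.inl ⟨ha, hb, hlt, hs⟩)
      · exact Or.inl (Or.inr ⟨(a, y), ⟨ha, hy, by dsimp only; omega⟩, rfl⟩)
      · have := hA b hb
        omega
      · exact Or.inr ⟨(x, y), ⟨hx, hy, by dsimp only; omega, by dsimp only; omega⟩, rfl⟩
    · rintro ((⟨ha, hb, hlt, hs⟩ | ⟨⟨x, y⟩, ⟨hx, hy, hs⟩, h⟩) | ⟨⟨x, y⟩, ⟨hx, hy, hlt, hs⟩, h⟩)
      · exact ⟨Or.inl ha, Or.inl hb, hlt, hs⟩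
      · obtain ⟨rfl, rfl⟩ := Prod.mk.inj h
        have := hA _ hx
        exact ⟨Or.inl hx, Or.inr ⟨y, hy, rfl⟩, by dsimp only at *; omega,
          by dsimp only at *; omega⟩
      · obtain ⟨rfl, rfl⟩ := Prod.mk.inj h
        exact ⟨Or.inr ⟨x, hx, rfl⟩, Or.inr ⟨y, hy, rfl⟩, by dsimp only at *; omega,
          by dsimp only at *; omega⟩
  have hd₁ : Disjoint P (f '' X) := by
    rw [Set.disjoint_left]
    rintro p hp ⟨q, -, rfl⟩
    have := hA _ hp.2.1
    dsimp only [f] at this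
    omega
  have hd₂ : Disjoint (P ∪ f '' X) (g '' Y) := by
    rw [Set.disjoint_left]
    rintro p hp ⟨q, -, rfl⟩
    have hmem : (g q).1 ∈ A := by
      rcases hp with hp | ⟨r, hr, h⟩
      · exact hp.1
      · rw [← h]
        exact hr.1
    have := hA _ hmem
    dsimp only [g] at this
    omega
  have hYc : Y.ncard = if 2 * k ≤ n then R B (n - 2 * k) else 0 := by
    split_ifs with h
    · unfold R
      congr 1
      ext p
      simp only [hY, Set.mem_ofPred_eq]
      have : p.1 + p.2 + 2 * k = n ↔ p.1 + p.2 = n - 2 * k := by omega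
      rw [this]
    · have : Y = ∅ := by
        ext p
        simp only [hY, Set.mem_ofPred_eq, Set.mem_empty_iff_false, iff_false]
        omega
      rw [this, Set.ncard_empty]
  rw [← hYc]
  change Set.ncard _ = P.ncard + X.ncard + Y.ncard
  rw [hset, Set.ncard_union_eq hd₂ (hPf.union (hXf.image f)) (hYf.image g),
    Set.ncard_union_eq hd₁ hPf (hXf.image f), Set.ncard_image_of_injective _ hf,
    Set.ncard_image_of_injective _ hg]

theorem ncard_cross_comm (A B : Set ℕ) (k n : ℕ) :
    {q : ℕ × ℕ | q.1 ∈ A ∧ q.2 ∈ B ∧ q.1 + q.2 + k = n}.ncard =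
      {q : ℕ × ℕ | q.1 ∈ B ∧ q.2 ∈ A ∧ q.1 + q.2 + k = n}.ncard := by
  rw [← Set.ncard_image_of_injective _ Prod.swap_injective]
  congr 1
  ext ⟨a, b⟩
  constructor
  · rintro ⟨⟨x, y⟩, ⟨hx, hy, hs⟩, h⟩
    obtain ⟨rfl, rfl⟩ := Prod.mk.inj h
    exact ⟨hy, hx, by dsimp only at *; omega⟩
  · rintro ⟨ha, hb, hs⟩
    exact ⟨(b, a), ⟨hb, ha, by dsimp only at *; omega⟩, rfl⟩

theorem R_singleton (a n : ℕ) : R {a} n = 0 := by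
  have : {p : ℕ × ℕ | p.1 ∈ ({a} : Set ℕ) ∧ p.2 ∈ ({a} : Set ℕ) ∧ p.1 < p.2 ∧ p.1 + p.2 = n}
      = ∅ := by
    ext p
    simp only [Set.mem_singleton_iff, Set.mem_ofPred_eq, Set.mem_empty_iff_false, iff_false]
    omega
  rw [R, this, Set.ncard_empty]

theorem CDseq2_mem_or_iff (i x : ℕ) :
    x ∈ (CDseq2 i).1 ∨ x ∈ (CDseq2 i).2 ↔ x < 2 ^ (i + 1) := by
  induction i generalizing x with
  | zero =>
    simp only [CDseq2, Set.mem_singleton_iff]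
    omega
  | succ i ih =>
    have h2 : 2 ^ (i + 1 + 1) = 2 ^ (i + 1) + 2 ^ (i + 1) := by ring
    rw [h2]
    constructor
    · rintro ((h | ⟨y, h, rfl⟩) | (h | ⟨y, h, rfl⟩))
      · have := (ih _).1 (Or.inl h)
        omega
      · have := (ih _).1 (Or.inr h)
        dsimp only
        omega
      · have := (ih _).1 (Or.inr h)
        omega
      · have := (ih _).1 (Or.inl h)
        dsimp only
        omega
    · intro h
      by_cases hx : x < 2 ^ (i + 1)
      · exact ((ih x).2 hx).imp Or.inl Or.inl
      · have hxe : 2 ^ (i + 1) + (x - 2 ^ (i + 1)) = x := by omega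
        exact ((ih (x - 2 ^ (i + 1))).2 (by omega)).symm.imp
          (fun h => Or.inr ⟨_, h, hxe⟩) (fun h => Or.inr ⟨_, h, hxe⟩)

theorem CDseq2_disjoint (i : ℕ) : Disjoint (CDseq2 i).1 (CDseq2 i).2 := by
  induction i with
  | zero => simp [CDseq2]
  | succ i ih =>
    rw [Set.disjoint_left] at ih ⊢
    have hC : ∀ y ∈ (CDseq2 i).1, y < 2 ^ (i + 1) := fun y h =>
      (CDseq2_mem_or_iff i y).1 (Or.inl h)
    have hD : ∀ y ∈ (CDseq2 i).2, y < 2 ^ (i + 1) := fun y h =>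
      (CDseq2_mem_or_iff i y).1 (Or.inr h)
    rintro x (h | ⟨y, h, rfl⟩) (h' | ⟨z, h', e⟩)
    · exact ih h h'
    · have := hC _ h
      dsimp only at e
      omega
    · have := hD _ h'
      dsimp only at this
      omega
    · obtain rfl : z = y := Nat.add_left_cancel e
      exact ih h' h

theorem R_CDseq2 (i n : ℕ) : R (CDseq2 i).1 n = R (CDseq2 i).2 n := by
  induction i generalizing n with
  | zero => simp only [CDseq2, R_singleton]
  | succ i ih =>
    simp only [CDseq2]
    rw [R_union_shift fun a h => (CDseq2_mem_or_iff i a).1 (Or.inl h),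
      R_union_shift fun a h => (CDseq2_mem_or_iff i a).1 (Or.inr h), ih n, ih (n - _),
      ncard_cross_comm]

theorem zero_mem_CDseq2_fst (i : ℕ) : 0 ∈ (CDseq2 i).1 := by
  induction i with
  | zero => rfl
  | succ i ih => exact Or.inl ih

theorem two_pow_sub_two_mem_CDseq2_fst (l : ℕ) :
    2 ^ (2 * l + 1) - 2 ∈ (CDseq2 (2 * l)).1 := by
  induction l with
  | zero => rfl
  | succ l ih =>
    refine Or.inr ⟨2 ^ (2 * l + 1) + (2 ^ (2 * l + 1) - 2), Or.inr ⟨_, ih, rfl⟩, ?_⟩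
    have hpos : 0 < 2 ^ (2 * l) := by positivity
    have e₁ : 2 ^ (2 * l + 1) = 2 * 2 ^ (2 * l) := by ring
    have e₂ : 2 ^ (2 * l + 1 + 1) = 4 * 2 ^ (2 * l) := by ring
    have e₃ : 2 ^ (2 * (l + 1) + 1) = 8 * 2 ^ (2 * l) := by ring
    change 2 ^ (2 * l + 1 + 1) + (2 ^ (2 * l + 1) + (2 ^ (2 * l + 1) - 2)) = _
    rw [e₃, e₁, e₂]
    omega

theorem stmt_16 (l : ℕ) (hl : 0 < l) :
    (∀ n : ℕ, R (CDseq2 (2 * l)).1 n = R (CDseq2 (2 * l)).2 n) ∧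
    (CDseq2 (2 * l)).1 ∪ (CDseq2 (2 * l)).2 = Set.Icc 0 (2 ^ (2 * l + 1) - 1) ∧
    (CDseq2 (2 * l)).1 ∩ (CDseq2 (2 * l)).2 = ∅ ∧
    0 ∈ (CDseq2 (2 * l)).1 ∧ 2 ^ (2 * l + 1) - 2 ∈ (CDseq2 (2 * l)).1 := by
  refine ⟨R_CDseq2 _, ?_, (CDseq2_disjoint _).inter_eq, zero_mem_CDseq2_fst _,
    two_pow_sub_two_mem_CDseq2_fst l⟩
  ext x
  have hpos : 0 < 2 ^ (2 * l + 1) := by positivity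
  rw [Set.mem_union, CDseq2_mem_or_iff, Set.mem_Icc]
  omega
end
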